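/- Let d ∈ ℕ with d ≥ 3. The number of subsets V ⊆ {0,1}^d such that the polytope conv(V) satisfies xc(conv(V)) ≤ 2^{d/2}/(9·d) is at most 2^{2^d}·2^{−2^{d−1}}. Equivalently, if P is a 0/1-polytope chosen uniformly at random among all 2^{2^d} 0/1-polytopes in ℝ^d, then Prob(xc(P) ≤ 2^{d/2}/(9·d)) ≤ 2^{−2^{d−1}}. -/

import Mathlib

open Metric Set

noncomputable section

/-- A polytope: convex hull of a finite set. -/
def IsPolytope {d : ℕ} (P : Set (EuclideanSpace ℝ (Fin d))) : Prop :=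
  ∃ V : Finset (EuclideanSpace ℝ (Fin d)), P = convexHull ℝ (V : Set (EuclideanSpace ℝ (Fin d)))

/-- `P` has an extended formulation with `l` LMIs of size `m`. -/
def HasSdpExtBlocks {d : ℕ} (P : Set (EuclideanSpace ℝ (Fin d))) (l m : ℕ) : Prop :=
  ∃ (n : ℕ) (φ : EuclideanSpace ℝ (Fin n) →ᵃ[ℝ] EuclideanSpace ℝ (Fin d))
    (M : Fin l → (EuclideanSpace ℝ (Fin n) →ᵃ[ℝ] Matrix (Fin m) (Fin m) ℝ)),
    (∀ i x, (M i x).IsSymm) ∧ P = φ '' {x | ∀ i, (M i x).PosSemidef}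

/-- `P` has an extended formulation with a single LMI of size `k`. -/
def HasSdpExt {d : ℕ} (P : Set (EuclideanSpace ℝ (Fin d))) (k : ℕ) : Prop :=
  ∃ (n : ℕ) (φ : EuclideanSpace ℝ (Fin n) →ᵃ[ℝ] EuclideanSpace ℝ (Fin d))
    (M : EuclideanSpace ℝ (Fin n) →ᵃ[ℝ] Matrix (Fin k) (Fin k) ℝ),
    (∀ x, (M x).IsSymm) ∧ P = φ '' {x | (M x).PosSemidef}

/-- `P` has an extended formulation with `l` linear inequalities. -/
def HasLinExt {d : ℕ} (P : Set (EuclideanSpace ℝ (Fin d))) (l : ℕ) : Prop :=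
  ∃ (n : ℕ) (φ : EuclideanSpace ℝ (Fin n) →ᵃ[ℝ] EuclideanSpace ℝ (Fin d))
    (a : Fin l → (EuclideanSpace ℝ (Fin n) →ᵃ[ℝ] ℝ)),
    P = φ '' {x | ∀ i, 0 ≤ a i x}

open Classical in
/-- Semidefinite extension complexity. -/
def sxc {d : ℕ} (P : Set (EuclideanSpace ℝ (Fin d))) : ℕ :=
  if P = ∅ ∨ ∃ p, P = {p} then 0 else sInf {k | HasSdpExt P k}

open Classical in
/-- Linear extension complexity. -/
def xc {d : ℕ} (P : Set (EuclideanSpace ℝ (Fin d))) : ℕ :=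
  if P = ∅ ∨ ∃ p, P = {p} then 0 else sInf {l | HasLinExt P l}

/-- Spectral norm of a square real matrix (the operator norm of the induced map
on Euclidean space; for a symmetric matrix this is the largest absolute value of
an eigenvalue). -/
def specNorm {ι : Type*} [Fintype ι] [DecidableEq ι] (T : Matrix ι ι ℝ) : ℝ :=
  ‖LinearMap.toContinuousLinearMap (Matrix.toEuclideanLin T)‖

/-- Norm of a linear map into square matrices: the maximum of the spectral norm
of the values over the unit ball. -/
def lmNorm {n : ℕ} {ι : Type*} [Fintype ι] [DecidableEq ι]
    (A : EuclideanSpace ℝ (Fin n) →ₗ[ℝ] Matrix ι ι ℝ) : ℝ :=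
  sSup {r | ∃ x : EuclideanSpace ℝ (Fin n), ‖x‖ ≤ 1 ∧ r = specNorm (A x)}

/-- A 0/1-polytope: the convex hull of a set of 0/1-vectors. -/
def IsZeroOnePolytope {d : ℕ} (P : Set (EuclideanSpace ℝ (Fin d))) : Prop :=
  ∃ V : Set (EuclideanSpace ℝ (Fin d)),
    V ⊆ {x | ∀ i, x i = 0 ∨ x i = 1} ∧ P = convexHull ℝ V


/-- Farkas lemma, inductive proof of Bartl. -/
lemma farkas_aux {W : Type*} [AddCommGroup W] [Module ℝ W] (m : ℕ) :
    ∀ (A : Fin m → W →ₗ[ℝ] ℝ) (γ : W →ₗ[ℝ] ℝ),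
      (∀ x, (∀ i, 0 ≤ A i x) → 0 ≤ γ x) →
      ∃ u : Fin m → ℝ, (∀ i, 0 ≤ u i) ∧ ∀ x, γ x = ∑ i, u i * A i x := by
  induction m with
  | zero =>
    intro A γ h
    refine ⟨fun _ => 0, fun i => le_rfl, fun x => ?_⟩
    have h1 := h x (fun i => i.elim0)
    have h2 := h (-x) (fun i => i.elim0)
    rw [map_neg] at h2
    simp
    linarith
  | succ m ih =>
    intro A γ h
    by_cases hc : ∀ x, (∀ i : Fin m, 0 ≤ A i.castSucc x) → 0 ≤ γ x
    · obtain ⟨u, hu, he⟩ := ih (fun i => A i.castSucc) γ hc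
      refine ⟨Fin.snoc u 0, ?_, ?_⟩
      · intro i
        refine Fin.lastCases ?_ (fun j => ?_) i
        · simp
        · simpa using hu j
      · intro x
        rw [Fin.sum_univ_castSucc]
        simpa using he x
    · push Not at hc
      obtain ⟨y, hy, hγ⟩ := hc
      have hB : A (Fin.last m) y < 0 := by
        by_contra hn
        push Not at hn
        have := h y (fun i => Fin.lastCases hn hy i)
        linarith
      set b := -A (Fin.last m) y with hb
      have hb0 : 0 < b := by linarith
      set x0 : W := b⁻¹ • y with hx0
      have hx1 : A (Fin.last m) x0 = -1 := by
        rw [hx0, map_smul, smul_eq_mul]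
        have : A (Fin.last m) y = -b := by linarith
        rw [this]; field_simp
      have hA0 : ∀ i : Fin m, 0 ≤ A i.castSucc x0 := fun i => by
        rw [hx0, map_smul, smul_eq_mul]
        exact mul_nonneg (by positivity) (hy i)
      have hγ0 : γ x0 ≤ 0 := by
        rw [hx0, map_smul, smul_eq_mul]
        exact mul_nonpos_of_nonneg_of_nonpos (by positivity) hγ.le
      obtain ⟨u, hu, he⟩ := ih (fun i => A i.castSucc + (A i.castSucc x0) • A (Fin.last m))
        (γ + (γ x0) • A (Fin.last m)) (by
          intro x hx
          have := h (x + A (Fin.last m) x • x0) (fun i => by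
            refine Fin.lastCases ?_ (fun j => ?_) i
            · simp [hx1]
            · have := hx j
              simp at this ⊢
              linarith)
          simp at this ⊢
          linarith)
      refine ⟨Fin.snoc u (∑ i, u i * A i.castSucc x0 - γ x0), ?_, ?_⟩
      · intro i
        refine Fin.lastCases ?_ (fun j => ?_) i
        · simp
          have := Finset.sum_nonneg (fun i (_ : i ∈ Finset.univ) => mul_nonneg (hu i) (hA0 i))
          linarith
        · simpa using hu j
      · intro x
        rw [Fin.sum_univ_castSucc]
        have := he x
        simp [mul_add, Finset.sum_add_distrib] at this ⊢
        rw [sub_mul, Finset.sum_mul]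
        simp only [← mul_assoc] at this
        linarith

/-- Barycentric spanner. -/
lemma exists_spanner {ι E : Type*} [Finite ι] [Nonempty ι] [AddCommGroup E] [Module ℝ E]
    [FiniteDimensional ℝ E] (n : ℕ) (hn : Module.finrank ℝ E ≤ n) (v : ι → E) :
    ∃ f : Fin n → ι, ∀ i, ∃ c : Fin n → ℝ, (∀ j, |c j| ≤ 1) ∧ v i = ∑ j, c j • v (f j) := by
  classical
  set S := Submodule.span ℝ (Set.range v) with hS
  set m := Module.finrank ℝ S with hm
  have hmn : m ≤ n := (Submodule.finrank_le S).trans hn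
  let b : Module.Basis (Fin m) ℝ S := Module.finBasis ℝ S
  let v' : ι → S := fun i => ⟨v i, Submodule.subset_span ⟨i, rfl⟩⟩
  have hspan : Submodule.span ℝ (Set.range v') = ⊤ := by
    have : Set.range v' = (Subtype.val : S → E) ⁻¹' Set.range v := by
      ext x
      simp [v', Subtype.ext_iff]
    rw [this]
    exact Submodule.span_span_coe_preimage
  have hfr : Module.finrank ℝ (Submodule.span ℝ (Set.range v')) = m := by
    rw [hspan, finrank_top]
  obtain ⟨g, hg, hgs, hgl⟩ := Submodule.exists_fun_fin_finrank_span_eq ℝ (Set.range v')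
  replace hgs := hgs.trans hspan
  choose h hh using hg
  obtain ⟨f, hf⟩ := Finite.exists_max (fun f : Fin m → ι => |b.det (v' ∘ f)|)
  have hpos : b.det (v' ∘ f) ≠ 0 := by
    have h1 := hf (fun j => h (Fin.cast hfr.symm j))
    have h2 : IsUnit (b.det (v' ∘ fun j => h (Fin.cast hfr.symm j))) := by
      rw [← Module.Basis.is_basis_iff_det]
      have e : (v' ∘ fun j => h (Fin.cast hfr.symm j)) = g ∘ (finCongr hfr.symm) := by
        funext j; simp [hh]
      rw [e]
      refine ⟨hgl.comp _ (finCongr hfr.symm).injective, ?_⟩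
      rw [Set.range_comp, (finCongr hfr.symm).surjective.range_eq, Set.image_univ, hgs]
    have h3 := abs_pos.mpr h2.ne_zero
    exact abs_pos.mp (lt_of_lt_of_le h3 h1)
  have hbas : LinearIndependent ℝ (v' ∘ f) ∧ Submodule.span ℝ (Set.range (v' ∘ f)) = ⊤ := by
    rw [Module.Basis.is_basis_iff_det b]
    exact isUnit_iff_ne_zero.mpr hpos
  obtain ⟨hli, hsp⟩ := hbas
  let B := Module.Basis.mk hli hsp.ge
  have hcoef : ∀ i j, |B.repr (v' i) j| ≤ 1 := by
    intro i j
    have h1 := congrArg (fun L => L (v' i)) (b.det_smul_mk_coord_eq_det_update hli hsp.ge j)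
    simp only [LinearMap.smul_apply, smul_eq_mul, MultilinearMap.toLinearMap_apply] at h1
    have h2 : Function.update (v' ∘ f) j (v' i) = v' ∘ (Function.update f j i) := by
      rw [Function.comp_update]
    rw [h2] at h1
    have h3 := hf (Function.update f j i)
    have h4 : |b.det (v' ∘ f)| * |B.repr (v' i) j| ≤ |b.det (v' ∘ f)| * 1 := by
      rw [← abs_mul, mul_one]
      calc _ = |b.det (v' ∘ (Function.update f j i))| := by
            congr 1
        _ ≤ _ := h3
    exact le_of_mul_le_mul_left h4 (abs_pos.mpr hpos)
  obtain ⟨i0⟩ := ‹Nonempty ι›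
  refine ⟨fun j => if hj : j.1 < m then f ⟨j, hj⟩ else i0, fun i => ?_⟩
  refine ⟨fun j => if hj : j.1 < m then B.repr (v' i) ⟨j, hj⟩ else 0, fun j => ?_, ?_⟩
  · dsimp only
    split_ifs
    · exact hcoef _ _
    · simp
  · have h1 := congrArg (Subtype.val) (B.sum_repr (v' i))
    have h2 : ∀ j, B j = v' (f j) := fun j => by simp [B]
    simp only [h2] at h1
    obtain ⟨p, rfl⟩ := Nat.exists_eq_add_of_le hmn
    rw [Fin.sum_univ_add]
    simp
    rw [← show (v' i).1 = v i from rfl, ← h1]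
    simp [v']

/-- The 0/1 value of a Boolean. -/
def pb (b : Bool) : ℝ := if b then 1 else 0

/-- `x ↦ ‖x - v‖₁ - 1` on the cube, written as an affine function. -/
def gfun {d : ℕ} (v : Fin d → Bool) (x : Fin d → ℝ) : ℝ :=
  (∑ i, pb (v i) - 1) + ∑ i, (1 - 2 * pb (v i)) * x i

lemma gfun_eq {d : ℕ} (v w : Fin d → Bool) :
    gfun v (fun i => pb (w i)) = ∑ i, (if v i = w i then (0 : ℝ) else 1) - 1 := by
  have : ∀ i, (if v i = w i then (0 : ℝ) else 1) = pb (v i) + (1 - 2 * pb (v i)) * pb (w i) := by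
    intro i
    cases v i <;> cases w i <;> norm_num [pb]
  simp only [this, Finset.sum_add_distrib, gfun]
  ring

lemma gfun_self {d : ℕ} (v : Fin d → Bool) : gfun v (fun i => pb (v i)) = -1 := by
  rw [gfun_eq]; simp

lemma gfun_nonneg {d : ℕ} (v w : Fin d → Bool) (h : v ≠ w) :
    0 ≤ gfun v (fun i => pb (w i)) := by
  rw [gfun_eq]
  obtain ⟨i, hi⟩ := Function.ne_iff.mp h
  have := Finset.single_le_sum (f := fun i => (if v i = w i then (0 : ℝ) else 1))
    (s := Finset.univ) (fun i _ => by split_ifs <;> norm_num) (Finset.mem_univ i)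
  simp only [hi, if_false] at this
  linarith

lemma gfun_le {d : ℕ} (v w : Fin d → Bool) : gfun v (fun i => pb (w i)) ≤ d := by
  rw [gfun_eq]
  have : ∑ i, (if v i = w i then (0 : ℝ) else 1) ≤ ∑ i : Fin d, (1 : ℝ) :=
    Finset.sum_le_sum (fun i _ => by split_ifs <;> norm_num)
  simp at this
  linarith

/-- nonnegative factorization of the partial slack matrix -/
def Factor {d : ℕ} (T : Set (Fin d → Bool)) (k : ℕ) : Prop :=
  ∃ (U W : (Fin d → Bool) → Fin k → ℝ), (∀ v ∉ T, ∀ j, 0 ≤ U v j) ∧ (∀ w ∈ T, ∀ j, 0 ≤ W w j) ∧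
    ∀ v ∉ T, ∀ w ∈ T, ∑ j, U v j * W w j = gfun v (fun i => pb (w i))

lemma Factor.normalize {d : ℕ} {T : Set (Fin d → Bool)} {k : ℕ} (h : Factor T k)
    (hT : T ≠ Set.univ) :
    ∃ (U W : (Fin d → Bool) → Fin k → ℝ), (∀ v ∉ T, ∀ j, 0 ≤ U v j ∧ U v j ≤ 1) ∧
      (∀ w ∈ T, ∀ j, 0 ≤ W w j ∧ W w j ≤ d) ∧
      ∀ v ∉ T, ∀ w ∈ T, ∑ j, U v j * W w j = gfun v (fun i => pb (w i)) := by
  obtain ⟨U, W, hU, hW, hUW⟩ := h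
  obtain ⟨v0, hv0⟩ := (Set.ne_univ_iff_exists_notMem T).mp hT
  have hmax : ∀ j, ∃ v, v ∉ T ∧ ∀ v' ∉ T, U v' j ≤ U v j := by
    intro j
    obtain ⟨a, ha, h⟩ := Set.exists_max_image Tᶜ (fun v => U v j) (Set.toFinite _) ⟨v0, hv0⟩
    exact ⟨a, ha, h⟩
  choose m hm hmm using hmax
  refine ⟨fun v j => U v j / U (m j) j, fun w j => U (m j) j * W w j, ?_, ?_, ?_⟩
  · intro v hv j
    exact ⟨div_nonneg (hU v hv j) (hU _ (hm j) j), div_le_one_of_le₀ (hmm j v hv) (hU _ (hm j) j)⟩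
  · intro w hw j
    refine ⟨mul_nonneg (hU _ (hm j) j) (hW w hw j), ?_⟩
    have h1 := hUW (m j) (hm j) w hw
    have h2 := Finset.single_le_sum (f := fun i => U (m j) i * W w i) (s := Finset.univ)
      (fun i _ => mul_nonneg (hU _ (hm j) i) (hW w hw i)) (Finset.mem_univ j)
    have h3 := gfun_le (m j) w
    linarith
  · intro v hv w hw
    rw [← hUW v hv w hw]
    refine Finset.sum_congr rfl (fun j _ => ?_)
    by_cases h0 : U (m j) j = 0
    · have : U v j = 0 := le_antisymm (h0 ▸ hmm j v hv) (hU v hv j)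
      simp [h0, this]
    · field_simp

/-- decoder -/
def decode {d k n : ℕ} (code : Fin n → (Fin d → Bool) × (Fin k → Fin (2 ^ d))) :
    Set (Fin d → Bool) :=
  {w | ∃ y : Fin k → ℝ, (∀ j, 0 ≤ y j ∧ y j ≤ d) ∧
    ∀ i, |gfun (code i).1 (fun l => pb (w l)) - ∑ j, (((code i).2 j : ℕ) / 2 ^ d : ℝ) * y j|
      ≤ k * d / 2 ^ d}

lemma exists_round (d : ℕ) (u : ℝ) (h0 : 0 ≤ u) (h1 : u ≤ 1) :
    ∃ q : Fin (2 ^ d), |u - ((q : ℕ) / 2 ^ d : ℝ)| ≤ 1 / 2 ^ d := by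
  have hp : (0 : ℝ) < 2 ^ d := by positivity
  rcases h1.eq_or_lt with rfl | h1
  · refine ⟨⟨2 ^ d - 1, by have : 0 < 2 ^ d := by positivity
                           omega⟩, ?_⟩
    have : ((2 ^ d - 1 : ℕ) : ℝ) = 2 ^ d - 1 := by
      rw [Nat.cast_sub Nat.one_le_two_pow]; simp
    simp only [this]
    rw [abs_of_nonneg] <;> · field_simp; simp
  · have hq : ⌊u * 2 ^ d⌋₊ < 2 ^ d := by
      rw [Nat.floor_lt (by positivity)]
      push_cast
      nlinarith
    refine ⟨⟨_, hq⟩, ?_⟩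
    have a1 := Nat.floor_le (a := u * 2 ^ d) (by positivity)
    have a2 := Nat.lt_floor_add_one (u * 2 ^ d)
    have : u - ((⌊u * 2 ^ d⌋₊ : ℕ) / 2 ^ d : ℝ) = (u * 2 ^ d - (⌊u * 2 ^ d⌋₊ : ℕ)) / 2 ^ d := by
      field_simp
    simp only [this]
    rw [abs_of_nonneg (div_nonneg (by linarith) hp.le)]
    gcongr
    linarith

lemma round_sum {d k : ℕ} (u q y : Fin k → ℝ) (h : ∀ j, |u j - q j| ≤ 1 / 2 ^ d)
    (hy : ∀ j, 0 ≤ y j ∧ y j ≤ d) :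
    |∑ j, u j * y j - ∑ j, q j * y j| ≤ k * d / 2 ^ d := by
  rw [← Finset.sum_sub_distrib]
  refine (Finset.abs_sum_le_sum_abs _ _).trans ?_
  have : ∀ j ∈ Finset.univ, |u j * y j - q j * y j| ≤ d / 2 ^ d := by
    intro j _
    rw [← sub_mul, abs_mul, abs_of_nonneg (hy j).1]
    calc _ ≤ 1 / 2 ^ d * (d : ℝ) := mul_le_mul (h j) (hy j).2 (hy j).1 (by positivity)
      _ = _ := by ring
  refine (Finset.sum_le_sum this).trans ?_
  simp
  rw [mul_div_assoc]

lemma Factor.exists_code {d : ℕ} {T : Set (Fin d → Bool)} {k : ℕ} (h : Factor T k)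
    (hT : T ≠ Set.univ) (hk : 2 * k * d * (k + 1 + d) < 2 ^ d) :
    ∃ code : Fin (k + 1 + d) → (Fin d → Bool) × (Fin k → Fin (2 ^ d)), decode code = T := by
  obtain ⟨U, W, hU, hW, hUW⟩ := h.normalize hT
  obtain ⟨v0, hv0⟩ := (Set.ne_univ_iff_exists_notMem T).mp hT
  have : Nonempty (Tᶜ : Set (Fin d → Bool)) := ⟨⟨v0, hv0⟩⟩
  obtain ⟨f, hf⟩ := exists_spanner (ι := (Tᶜ : Set (Fin d → Bool)))
    (E := ((Fin k → ℝ) × ℝ) × (Fin d → ℝ)) (k + 1 + d) (by simp)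
    (fun v => ((U v.1, ∑ i, pb (v.1 i) - 1), fun i => 1 - 2 * pb (v.1 i)))
  have hq : ∀ v : (Tᶜ : Set (Fin d → Bool)), ∀ j, ∃ q : Fin (2 ^ d),
      |U v.1 j - ((q : ℕ) / 2 ^ d : ℝ)| ≤ 1 / 2 ^ d := fun v j =>
    exists_round d _ (hU v.1 v.2 j).1 (hU v.1 v.2 j).2
  choose q hq using hq
  refine ⟨fun i => ((f i).1, q (f i)), ?_⟩
  ext w
  constructor
  · rintro ⟨y, hy, hc⟩
    by_contra hw
    obtain ⟨c, hc1, hc2⟩ := hf ⟨w, hw⟩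
    have e1 : ∀ j, U w j = ∑ i, c i * U (f i).1 j := fun j => by
      have := congrArg (fun z => z.1.1 j) hc2
      simpa [Prod.fst_sum, Prod.snd_sum] using this
    have e2 : ∑ i, pb (w i) - 1 = ∑ i, c i * (∑ l, pb ((f i).1 l) - 1) := by
      have := congrArg (fun z => z.1.2) hc2
      simpa [Prod.fst_sum, Prod.snd_sum] using this
    have e3 : ∀ l, 1 - 2 * pb (w l) = ∑ i, c i * (1 - 2 * pb ((f i).1 l)) := fun l => by
      have := congrArg (fun z => z.2 l) hc2
      simpa [Prod.fst_sum, Prod.snd_sum] using this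
    have key : gfun w (fun l => pb (w l)) - ∑ j, U w j * y j =
        ∑ i, c i * (gfun (f i).1 (fun l => pb (w l)) - ∑ j, U (f i).1 j * y j) := by
      have e4 : ∑ j, U w j * y j = ∑ i, c i * ∑ j, U (f i).1 j * y j := by
        simp only [e1, Finset.sum_mul, Finset.mul_sum]
        rw [Finset.sum_comm]
        simp only [mul_assoc]
      have e5 : ∑ l, (1 - 2 * pb (w l)) * pb (w l)
          = ∑ i, c i * ∑ l, (1 - 2 * pb ((f i).1 l)) * pb (w l) := by
        have : ∀ l, (1 - 2 * pb (w l)) * pb (w l)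
            = ∑ i, c i * ((1 - 2 * pb ((f i).1 l)) * pb (w l)) := fun l => by
          rw [e3 l, Finset.sum_mul]
          simp only [mul_assoc]
        simp only [this, Finset.mul_sum]
        rw [Finset.sum_comm]
      simp only [mul_sub, Finset.sum_sub_distrib, ← e4]
      congr 1
      unfold gfun
      rw [e5, e2]
      simp only [mul_add, Finset.sum_add_distrib]
    rw [gfun_self] at key
    have hnn : 0 ≤ ∑ j, U w j * y j :=
      Finset.sum_nonneg (fun j _ => mul_nonneg (hU w hw j).1 (hy j).1)
    have hb : ∀ i ∈ Finset.univ, |c i * (gfun (f i).1 (fun l => pb (w l)) - ∑ j, U (f i).1 j * y j)|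
        ≤ 2 * (k * d / 2 ^ d : ℝ) := by
      intro i _
      have h1 := hc i
      have h2 := round_sum (U (f i).1) (fun j => ((q (f i) j : ℕ) / 2 ^ d : ℝ)) y (hq (f i)) hy
      rw [abs_mul]
      have h3 : |gfun (f i).1 (fun l => pb (w l)) - ∑ j, U (f i).1 j * y j|
          ≤ 2 * (k * d / 2 ^ d : ℝ) := by
        rw [abs_le] at *
        dsimp only at *
        constructor <;> linarith [h1.1, h1.2, h2.1, h2.2]
      exact (mul_le_of_le_one_left (abs_nonneg _) (hc1 i)).trans h3
    have hs := (Finset.abs_sum_le_sum_abs _ _).trans (Finset.sum_le_sum hb)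
    rw [← key] at hs
    simp at hs
    have h1 : (1 : ℝ) ≤ |-1 - ∑ j, U w j * y j| := by
      rw [abs_of_nonpos (by linarith)]; linarith
    have h2 : ((k : ℝ) + 1 + d) * (2 * (k * d / 2 ^ d)) < 1 := by
      have : ((2 * k * d * (k + 1 + d) : ℕ) : ℝ) < ((2 ^ d : ℕ) : ℝ) := by exact_mod_cast hk
      push_cast at this
      have e : ((k : ℝ) + 1 + d) * (2 * (k * d / 2 ^ d)) = (2 * k * d * (k + 1 + d)) / 2 ^ d := by
        ring
      rw [e, div_lt_one (by positivity)]
      exact this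
    linarith
  · intro hw
    refine ⟨W w, hW w hw, fun i => ?_⟩
    dsimp only
    rw [← hUW _ (f i).2 w hw]
    exact round_sum (U (f i).1) (fun j => ((q (f i) j : ℕ) / 2 ^ d : ℝ)) (W w) (hq (f i)) (hW w hw)

lemma farkas_affine {E : Type*} [AddCommGroup E] [Module ℝ E] {l : ℕ} (a : Fin l → E →ᵃ[ℝ] ℝ)
    (γ : E →ᵃ[ℝ] ℝ) (x0 : E) (hx0 : ∀ i, 0 ≤ a i x0)
    (h : ∀ x, (∀ i, 0 ≤ a i x) → 0 ≤ γ x) :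
    ∃ u : Fin (l + 1) → ℝ, (∀ i, 0 ≤ u i) ∧
      ∀ x, γ x = ∑ i : Fin l, u i.castSucc * a i x + u (Fin.last l) := by
  let hom : (E →ᵃ[ℝ] ℝ) → (E × ℝ) →ₗ[ℝ] ℝ := fun b =>
    b.linear ∘ₗ LinearMap.fst ℝ E ℝ + (b 0) • LinearMap.snd ℝ E ℝ
  have hdec : ∀ (b : E →ᵃ[ℝ] ℝ) x, b x = b.linear x + b 0 := fun b x => by
    conv_lhs => rw [AffineMap.decomp b]
    simp
  have hhom : ∀ b x t, hom b (x, t) = b.linear x + b 0 * t := fun b x t => by simp [hom]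
  obtain ⟨u, hu, he⟩ := farkas_aux (W := E × ℝ) (l + 1)
    (Fin.snoc (fun i => hom (a i)) (LinearMap.snd ℝ E ℝ)) (hom γ) (by
      rintro ⟨x, t⟩ hx
      have ht : 0 ≤ t := by simpa using hx (Fin.last l)
      have hxi : ∀ i : Fin l, 0 ≤ (a i).linear x + a i 0 * t := fun i => by
        have := hx i.castSucc
        simpa [hhom] using this
      rw [hhom]
      rcases ht.eq_or_lt with rfl | ht
      · simp only [mul_zero, add_zero] at hxi ⊢
        by_contra hn
        push Not at hn
        have hs : ∀ s : ℝ, 0 ≤ s → 0 ≤ γ x0 + s * γ.linear x := fun s hs => by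
          have := h (x0 + s • x) (fun i => by
            have h1 := hx0 i
            rw [hdec] at h1 ⊢
            rw [map_add, map_smul, smul_eq_mul]
            have := mul_nonneg hs (hxi i)
            linarith)
          rw [hdec, map_add, map_smul, smul_eq_mul] at this
          rw [hdec γ x0]
          linarith
        have h0 : 0 ≤ γ x0 := h x0 hx0
        have h1 := hs ((γ x0 + 1) / (-γ.linear x)) (div_nonneg (by linarith) (by linarith))
        have h2 : (γ x0 + 1) / (-γ.linear x) * γ.linear x = -(γ x0 + 1) := by
          have := hn.ne
          field_simp
        linarith
      · have := h (t⁻¹ • x) (fun i => by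
          rw [hdec, map_smul, smul_eq_mul]
          have h1 := mul_nonneg (inv_nonneg.mpr ht.le) (hxi i)
          have h2 : t⁻¹ * ((a i).linear x + a i 0 * t) = t⁻¹ * (a i).linear x + a i 0 := by
            field_simp
          linarith)
        rw [hdec, map_smul, smul_eq_mul] at this
        have h1 := mul_nonneg ht.le this
        have h2 : t * (t⁻¹ * γ.linear x + γ 0) = γ.linear x + γ 0 * t := by
          field_simp
        linarith)
  refine ⟨u, hu, fun x => ?_⟩
  have := he (x, 1)
  rw [hhom, Fin.sum_univ_castSucc] at this
  simp only [Fin.snoc_castSucc, Fin.snoc_last, hhom, LinearMap.snd_apply, mul_one, ← hdec] at this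
  exact this

/-- The cube vertex in Euclidean space. -/
def pt {d : ℕ} (w : Fin d → Bool) : EuclideanSpace ℝ (Fin d) :=
  WithLp.toLp 2 (fun i => pb (w i))

/-- `gfun` as an affine map. -/
def gaff {d : ℕ} (v : Fin d → Bool) : EuclideanSpace ℝ (Fin d) →ᵃ[ℝ] ℝ :=
  (∑ i, (1 - 2 * pb (v i)) • (EuclideanSpace.proj i :
    EuclideanSpace ℝ (Fin d) →L[ℝ] ℝ).toLinearMap).toAffineMap +
    AffineMap.const ℝ _ (∑ i, pb (v i) - 1)

lemma gaff_apply {d : ℕ} (v : Fin d → Bool) (x : EuclideanSpace ℝ (Fin d)) :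
    gaff v x = gfun v (fun i => x i) := by
  simp [gaff, gfun, add_comm]

lemma factor_of_ext {d l : ℕ} (T : Set (Fin d → Bool)) (hT : T.Nonempty)
    (h : HasLinExt (convexHull ℝ (pt '' T)) l) : Factor T (l + 1) := by
  classical
  obtain ⟨n, φ, a, hP⟩ := h
  have hx : ∀ w ∈ T, ∃ x, (∀ i, 0 ≤ a i x) ∧ φ x = pt w := by
    intro w hw
    have : pt w ∈ convexHull ℝ (pt '' T) := subset_convexHull ℝ _ ⟨w, hw, rfl⟩
    rw [hP] at this
    exact this
  choose! X hX1 hX2 using hx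
  obtain ⟨w0, hw0⟩ := hT
  have hU : ∀ v, v ∉ T → ∃ u : Fin (l + 1) → ℝ, (∀ i, 0 ≤ u i) ∧
      ∀ x, gaff v (φ x) = ∑ i : Fin l, u i.castSucc * a i x + u (Fin.last l) := by
    intro v hv
    refine farkas_affine a ((gaff v).comp φ) (X w0) (hX1 w0 hw0) (fun x hx => ?_)
    have h1 : φ x ∈ convexHull ℝ (pt '' T) := by
      rw [hP]; exact ⟨x, hx, rfl⟩
    have h2 : convexHull ℝ (pt '' T) ⊆ gaff v ⁻¹' (Set.Ici 0) := by
      refine convexHull_min ?_ ((convex_Ici (𝕜 := ℝ) (0 : ℝ)).affine_preimage (gaff v))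
      rintro _ ⟨w, hw, rfl⟩
      have := gfun_nonneg v w (by rintro rfl; exact hv hw)
      simpa [gaff_apply, pt] using this
    exact h2 h1
  choose! u hu1 hu2 using hU
  refine ⟨u, fun w => Fin.snoc (fun i => a i (X w)) 1, hu1, ?_, ?_⟩
  · intro w hw j
    refine Fin.lastCases ?_ (fun i => ?_) j
    · simp
    · simpa using hX1 w hw i
  · intro v hv w hw
    have := hu2 v hv (X w)
    rw [hX2 w hw, gaff_apply] at this
    rw [Fin.sum_univ_castSucc]
    simpa [pt] using this.symm

lemma HasLinExt.mono {d l l' : ℕ} {P : Set (EuclideanSpace ℝ (Fin d))} (h : HasLinExt P l)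
    (hl : l ≤ l') : HasLinExt P l' := by
  obtain ⟨n, φ, a, hP⟩ := h
  refine ⟨n, φ, fun i => if hi : i.1 < l then a ⟨i, hi⟩ else 0, ?_⟩
  rw [hP]
  congr 1
  ext x
  constructor
  · intro hx i
    by_cases hi : i.1 < l
    · simpa [hi] using hx ⟨i, hi⟩
    · simp [hi]
  · intro hx i
    have := hx ⟨i, i.2.trans_le hl⟩
    simpa using this

lemma hasLinExt_singleton {d : ℕ} (p : EuclideanSpace ℝ (Fin d)) : HasLinExt {p} 0 := by
  refine ⟨0, AffineMap.const ℝ _ p, Fin.elim0, ?_⟩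
  ext x
  simp [eq_comm]

lemma exists_hasLinExt {d : ℕ} (V : Set (EuclideanSpace ℝ (Fin d))) (hV : V.Finite) :
    ∃ l, HasLinExt (convexHull ℝ V) l := by
  obtain ⟨N, v, rfl⟩ : ∃ (N : ℕ) (v : Fin N → EuclideanSpace ℝ (Fin d)), Set.range v = V := by
    obtain ⟨N, v, hv⟩ := hV.fin_param
    exact ⟨N, v, hv.2⟩
  let S : EuclideanSpace ℝ (Fin N) →ₗ[ℝ] ℝ :=
    ∑ i, (EuclideanSpace.proj i : EuclideanSpace ℝ (Fin N) →L[ℝ] ℝ).toLinearMap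
  let φ : EuclideanSpace ℝ (Fin N) →ₗ[ℝ] EuclideanSpace ℝ (Fin d) :=
    Fintype.linearCombination ℝ v ∘ₗ (WithLp.linearEquiv 2 ℝ (Fin N → ℝ)).toLinearMap
  refine ⟨N + 1 + 1, N, φ.toAffineMap,
    Fin.snoc (α := fun _ => EuclideanSpace ℝ (Fin N) →ᵃ[ℝ] ℝ)
      (Fin.snoc (α := fun _ => EuclideanSpace ℝ (Fin N) →ᵃ[ℝ] ℝ) (fun i =>
      (EuclideanSpace.proj i : EuclideanSpace ℝ (Fin N) →L[ℝ] ℝ).toLinearMap.toAffineMap)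
      (S.toAffineMap - AffineMap.const ℝ _ 1)) (AffineMap.const ℝ _ 1 - S.toAffineMap), ?_⟩
  have h1 : convexHull ℝ (Set.range v) =
      Fintype.linearCombination ℝ v '' stdSimplex ℝ (Fin N) := by
    rw [← convexHull_basis_eq_stdSimplex, LinearMap.image_convexHull, ← Set.range_comp]
    congr 2
    funext i
    simp [Fintype.linearCombination_apply]
  rw [h1]
  ext p
  constructor
  · rintro ⟨x, hx, rfl⟩
    refine ⟨WithLp.toLp 2 x, fun i => ?_, by simp [φ]⟩
    refine Fin.lastCases ?_ (fun i => Fin.lastCases ?_ (fun i => ?_) i) i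
    · simp [S, hx.2]
    · simp [S, hx.2]
    · simpa using hx.1 i
  · rintro ⟨x, hx, rfl⟩
    refine ⟨WithLp.ofLp x, ⟨fun i => ?_, ?_⟩, by simp [φ]⟩
    · simpa using hx i.castSucc.castSucc
    · have a1 := hx (Fin.last _)
      have a2 := hx (Fin.last _).castSucc
      simp [S] at a1 a2
      linarith

lemma hasLinExt_xc {d : ℕ} (V : Set (EuclideanSpace ℝ (Fin d))) (hV : V.Finite)
    (hne : V.Nonempty) : HasLinExt (convexHull ℝ V) (xc (convexHull ℝ V)) := by
  unfold xc
  split_ifs with h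
  · rcases h with h | ⟨p, h⟩
    · exact absurd h hne.convexHull.ne_empty
    · rw [h]; exact hasLinExt_singleton p
  · exact Nat.sInf_mem (exists_hasLinExt V hV)

lemma pt_mem {d : ℕ} (V : Set (EuclideanSpace ℝ (Fin d))) (h : V ⊆ {x | ∀ i, x i = 0 ∨ x i = 1}) :
    ∃ T : Set (Fin d → Bool), pt '' T = V := by
  refine ⟨pt ⁻¹' V, Set.image_preimage_eq_of_subset ?_⟩
  intro x hx
  refine ⟨fun i => decide (x i = 1), ?_⟩
  ext i
  rcases h hx i with h0 | h0 <;> simp [pt, pb, h0]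

lemma subsingleton_of_ext_zero {d : ℕ} (T : Set (Fin d → Bool))
    (h : HasLinExt (convexHull ℝ (pt '' T)) 0) : T.Subsingleton := by
  obtain ⟨n, φ, a, hP⟩ := h
  have hb : ∀ x i, 0 ≤ φ x i ∧ φ x i ≤ 1 := by
    intro x i
    have h1 : φ x ∈ convexHull ℝ (pt '' T) := by
      rw [hP]; exact ⟨x, fun i => i.elim0, rfl⟩
    have h2 : convexHull ℝ (pt '' T) ⊆ (EuclideanSpace.proj i :
        EuclideanSpace ℝ (Fin d) →L[ℝ] ℝ).toLinearMap ⁻¹' (Set.Icc 0 1) := by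
      refine convexHull_min ?_ ((convex_Icc (𝕜 := ℝ) (0 : ℝ) 1).linear_preimage _)
      rintro _ ⟨w, hw, rfl⟩
      simp only [pt, Set.mem_preimage]
      cases h : w i <;> simp [pb, h]
    exact h2 h1
  intro s hs t ht
  have hm : ∀ w ∈ T, ∃ x, φ x = pt w := by
    intro w hw
    have : pt w ∈ convexHull ℝ (pt '' T) := subset_convexHull ℝ _ ⟨w, hw, rfl⟩
    rw [hP] at this
    obtain ⟨x, _, hx⟩ := this
    exact ⟨x, hx⟩
  obtain ⟨x, hx⟩ := hm s hs
  obtain ⟨y, hy⟩ := hm t ht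
  funext i
  have e : ∀ c : ℝ, φ (AffineMap.lineMap x y c) i = c * (pb (t i) - pb (s i)) + pb (s i) := by
    intro c
    rw [AffineMap.apply_lineMap, hx, hy]
    simp [AffineMap.lineMap_apply, pt]
  have a1 := hb (AffineMap.lineMap x y (2 : ℝ)) i
  have a2 := hb (AffineMap.lineMap x y (-2 : ℝ)) i
  rw [e] at a1 a2
  cases h1 : s i <;> cases h2 : t i <;> simp [h1, h2, pb] at a1 a2 ⊢

lemma rhs_eq (d : ℕ) (hd : 3 ≤ d) :
    (2 : ℝ) ^ ((2 : ℝ) ^ (d : ℝ)) * (2 : ℝ) ^ (-((2 : ℝ) ^ ((d : ℝ) - 1))) =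
      ((2 ^ (2 ^ (d - 1)) : ℕ) : ℝ) := by
  obtain ⟨e, rfl⟩ : ∃ e, d = e + 1 := ⟨d - 1, by omega⟩
  rw [← Real.rpow_add (by norm_num)]
  have h1 : ((e + 1 : ℕ) : ℝ) - 1 = (e : ℕ) := by push_cast; ring
  rw [h1, Real.rpow_natCast, Real.rpow_natCast]
  have h2 : (2 : ℝ) ^ (e + 1) + -(2 : ℝ) ^ e = ((2 ^ e : ℕ) : ℝ) := by
    push_cast; ring
  rw [h2, Real.rpow_natCast]
  simp

theorem statement13 (d : ℕ) (hd : 3 ≤ d) :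
    {V : Set (EuclideanSpace ℝ (Fin d)) | V ⊆ {x | ∀ i, x i = 0 ∨ x i = 1} ∧
        (xc (convexHull ℝ V) : ℝ) ≤ (2 : ℝ) ^ ((d : ℝ) / 2) / (9 * d)}.Finite ∧
    ({V : Set (EuclideanSpace ℝ (Fin d)) | V ⊆ {x | ∀ i, x i = 0 ∨ x i = 1} ∧
        (xc (convexHull ℝ V) : ℝ) ≤ (2 : ℝ) ^ ((d : ℝ) / 2) / (9 * d)}.ncard : ℝ)
      ≤ (2 : ℝ) ^ ((2 : ℝ) ^ (d : ℝ)) * (2 : ℝ) ^ (-((2 : ℝ) ^ ((d : ℝ) - 1))) := by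
  rw [rhs_eq d hd]
  set X : ℝ := (2 : ℝ) ^ ((d : ℝ) / 2) / (9 * d) with hX
  set fam := {V : Set (EuclideanSpace ℝ (Fin d)) | V ⊆ {x | ∀ i, x i = 0 ∨ x i = 1} ∧
        (xc (convexHull ℝ V) : ℝ) ≤ X} with hfam
  have hX0 : 0 ≤ X := by positivity
  set R := ⌊X⌋₊ with hR
  -- it suffices to cover by a small family of vertex sets
  suffices hmain : ∃ 𝓣 : Set (Set (Fin d → Bool)), 𝓣.ncard ≤ 2 ^ (2 ^ (d - 1)) ∧
      ∀ T : Set (Fin d → Bool), (T.Nonempty → HasLinExt (convexHull ℝ (pt '' T)) R) → T ∈ 𝓣 by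
    obtain ⟨𝓣, hc, hcov⟩ := hmain
    have hsub : fam ⊆ (fun T => pt '' T) '' 𝓣 := by
      rintro V ⟨hV1, hV2⟩
      obtain ⟨T, rfl⟩ := pt_mem V hV1
      refine ⟨T, hcov T (fun hne => ?_), rfl⟩
      exact (hasLinExt_xc _ (Set.toFinite _) (hne.image _)).mono (Nat.le_floor hV2)
    have hfin : 𝓣.Finite := Set.toFinite _
    refine ⟨(hfin.image _).subset hsub, ?_⟩
    exact_mod_cast ((Set.ncard_le_ncard hsub (hfin.image _)).trans
      (Set.ncard_image_le hfin)).trans hc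
  rcases Nat.eq_zero_or_pos R with hR0 | hRpos
  · refine ⟨insert ∅ (Set.range (fun s => ({s} : Set (Fin d → Bool)))), ?_, ?_⟩
    · refine (Set.ncard_insert_le _ _).trans ?_
      have h1 : (Set.range (fun s => ({s} : Set (Fin d → Bool)))).ncard ≤ 2 ^ d := by
        rw [← Set.image_univ]
        refine (Set.ncard_image_le (Set.toFinite _)).trans ?_
        rw [Set.ncard_univ]
        simp
      have h2 : d + 1 ≤ 2 ^ (d - 1) := by
        obtain ⟨e, rfl⟩ : ∃ e, d = e + 3 := ⟨d - 3, by omega⟩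
        clear * -
        induction e with
        | zero => norm_num
        | succ e ih =>
          have : 2 ^ (e + 1 + 3 - 1) = 2 * 2 ^ (e + 3 - 1) := by
            rw [show e + 1 + 3 - 1 = (e + 3 - 1) + 1 by omega, pow_succ]; ring
          omega
      have h3 : 2 ^ (d + 1) ≤ 2 ^ (2 ^ (d - 1)) := Nat.pow_le_pow_right (by norm_num) h2
      have h4 : 2 ^ (d + 1) = 2 * 2 ^ d := by ring
      have h5 : 1 ≤ 2 ^ d := Nat.one_le_two_pow
      omega
    · intro T hT
      rcases T.eq_empty_or_nonempty with rfl | hne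
      · exact Set.mem_insert _ _
      · refine Set.mem_insert_of_mem _ ?_
        have := hT hne
        rw [hR0] at this
        obtain ⟨s, hs⟩ := hne
        exact ⟨s, ((subsingleton_of_ext_zero T this).eq_singleton_of_mem hs).symm⟩
  · have hRX : (R : ℝ) ≤ X := Nat.floor_le hX0
    have hkey : 81 * (d ^ 2 * R ^ 2) ≤ 2 ^ d := by
      have hdp : (0 : ℝ) < d := by
        have : 0 < d := by omega
        exact_mod_cast this
      have h1 : (R : ℝ) * (9 * d) ≤ (2 : ℝ) ^ ((d : ℝ) / 2) := by
        rwa [hX, le_div_iff₀ (by positivity)] at hRX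
      have h2 := pow_le_pow_left₀ (by positivity) h1 2
      rw [← Real.rpow_natCast ((2 : ℝ) ^ ((d : ℝ) / 2)) 2, ← Real.rpow_mul (by norm_num)] at h2
      have h3 : (d : ℝ) / 2 * (2 : ℕ) = (d : ℕ) := by push_cast; ring
      rw [h3, Real.rpow_natCast] at h2
      have h4 : ((81 * (d ^ 2 * R ^ 2) : ℕ) : ℝ) ≤ ((2 ^ d : ℕ) : ℝ) := by
        push_cast
        calc _ = ((R : ℝ) * (9 * d)) ^ 2 := by ring
          _ ≤ _ := h2
      exact_mod_cast h4
    have hdR : d * R * (d * R) = d ^ 2 * R ^ 2 := by ring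
    have hsq : 1 ≤ d ^ 2 * R ^ 2 := Nat.one_le_iff_ne_zero.mpr (by positivity)
    have hk1 : R + 1 ≤ 2 * R := by omega
    have hn1 : R + 1 + 1 + d ≤ 2 * (d * R) := by nlinarith
    have hb1 : 2 * (R + 1) * d * (R + 1 + 1 + d) < 2 ^ d := by
      calc 2 * (R + 1) * d * (R + 1 + 1 + d) ≤ 2 * (2 * R) * d * (2 * (d * R)) := by gcongr
        _ = 8 * (d ^ 2 * R ^ 2) := by ring
        _ < 2 ^ d := by omega
    have hb2 : d * (R + 1 + 1) * (R + 1 + 1 + d) + 2 ≤ 2 ^ (d - 1) := by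
      have : d * (R + 1 + 1) * (R + 1 + 1 + d) ≤ d * (3 * R) * (2 * (d * R)) := by
        gcongr
        omega
      have h2 : d * (3 * R) * (2 * (d * R)) = 6 * (d ^ 2 * R ^ 2) := by ring
      have h3 : 2 ^ d = 2 * 2 ^ (d - 1) := by
        rw [← pow_succ']; congr 1; omega
      omega
    refine ⟨insert ∅ (insert Set.univ (Set.range
      (decode (d := d) (k := R + 1) (n := R + 1 + 1 + d)))), ?_, ?_⟩
    · have h1 : (Set.range (decode (d := d) (k := R + 1) (n := R + 1 + 1 + d))).ncard
          ≤ 2 ^ (d * (R + 1 + 1) * (R + 1 + 1 + d)) := by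
        rw [← Set.image_univ]
        refine (Set.ncard_image_le (Set.toFinite _)).trans ?_
        rw [Set.ncard_univ, Nat.card_eq_fintype_card]
        simp only [Fintype.card_fun, Fintype.card_prod, Fintype.card_bool, Fintype.card_fin]
        apply le_of_eq
        rw [← pow_mul, ← pow_add, ← pow_mul]
        congr 1
        ring
      have h2 := Set.ncard_insert_le (∅ : Set (Fin d → Bool)) (insert Set.univ (Set.range
        (decode (d := d) (k := R + 1) (n := R + 1 + 1 + d))))
      have h3 := Set.ncard_insert_le (Set.univ : Set (Fin d → Bool)) (Set.range
        (decode (d := d) (k := R + 1) (n := R + 1 + 1 + d)))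
      have h4 := Nat.pow_le_pow_right (n := 2) (by norm_num) hb2
      have h5 : 2 ^ (d * (R + 1 + 1) * (R + 1 + 1 + d) + 2)
        = 4 * 2 ^ (d * (R + 1 + 1) * (R + 1 + 1 + d)) := by rw [pow_add]; ring
      have h6 : 1 ≤ 2 ^ (d * (R + 1 + 1) * (R + 1 + 1 + d)) := Nat.one_le_two_pow
      omega
    · intro T hT
      rcases T.eq_empty_or_nonempty with rfl | hne
      · exact Set.mem_insert _ _
      · refine Set.mem_insert_of_mem _ ?_
        by_cases hu : T = Set.univ
        · rw [hu]; exact Set.mem_insert _ _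
        · refine Set.mem_insert_of_mem _ ?_
          exact (factor_of_ext T hne (hT hne)).exists_code hu hb1
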